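/- If an infinite binary sequence X is partial computably random, then X is not strongly predictable. -/

import Mathlib

/-- The first `n` bits of the infinite binary sequence `X` (as a finite binary string). -/
def pre (X : ℕ → Bool) (n : ℕ) : List Bool := (List.range n).map X

/-- A martingale: nonnegative betting strategy with the fairness condition. -/
def IsMartingale (B : List Bool → ℝ) : Prop :=
  (∀ x, 0 ≤ B x) ∧ ∀ x, B (x ++ [false]) + B (x ++ [true]) = 2 * B x

/-- `B` succeeds on `X`: the capital along `X` is unbounded. -/
def Succeeds (B : List Bool → ℝ) (X : ℕ → Bool) : Prop := ∀ C : ℝ, ∃ n, C < B (pre X n)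

/-- A computable martingale: `{(x,q) | q < B x}` is decidable. -/
def ComputableMartingale (B : List Bool → ℝ) : Prop :=
  IsMartingale B ∧ ∃ g : List Bool × ℚ → Bool, Computable g ∧
    ∀ p : List Bool × ℚ, g p = true ↔ (p.2 : ℝ) < B p.1

def ComputablyRandom (X : ℕ → Bool) : Prop :=
  ∀ B : List Bool → ℝ, ComputableMartingale B → ¬ Succeeds B X

def TotalStronglyPredictable (X : ℕ → Bool) : Prop :=
  ∃ F : List Bool → Option Bool, Computable F ∧
    (∀ n b, F (pre X n) = some b → b = X n) ∧
    {n : ℕ | F (pre X n) ≠ none}.Infinite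

def StronglyPredictable (X : ℕ → Bool) : Prop :=
  ∃ F : List Bool →. Option Bool, Partrec F ∧
    (∀ n, (F (pre X n)).Dom) ∧
    (∀ n b, some b ∈ F (pre X n) → b = X n) ∧
    {n : ℕ | ∃ b, some b ∈ F (pre X n)}.Infinite

def PartialComputableMartingale (B : List Bool →. ℚ) : Prop :=
  Partrec B ∧
  (∀ x q, q ∈ B x → 0 ≤ q) ∧
  (∀ x y : List Bool, x <+: y → (B y).Dom → (B x).Dom) ∧
  (∀ x : List Bool, (B x).Dom → ((B (x ++ [false])).Dom ↔ (B (x ++ [true])).Dom)) ∧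
  (∀ (x : List Bool) (q q₀ q₁ : ℚ), q ∈ B x → q₀ ∈ B (x ++ [false]) → q₁ ∈ B (x ++ [true]) →
    q₀ + q₁ = 2 * q)

def PSucceeds (B : List Bool →. ℚ) (X : ℕ → Bool) : Prop :=
  (∀ n, (B (pre X n)).Dom) ∧ ∀ C : ℚ, ∃ n, ∃ q ∈ B (pre X n), C < q

def PartialComputablyRandom (X : ℕ → Bool) : Prop :=
  ∀ B : List Bool →. ℚ, PartialComputableMartingale B → ¬ PSucceeds B X

def FiniteStateStronglyPredictable (X : ℕ → Bool) : Prop :=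
  ∃ (Q : Type) (_ : Fintype Q) (δ : Q → Bool → Q) (q₀ : Q) (f : Q → Option Bool),
    (∀ n b, f ((pre X n).foldl δ q₀) = some b → b = X n) ∧
    {n : ℕ | f ((pre X n).foldl δ q₀) ≠ none}.Infinite

/-- A prefix-free machine: a partial computable function with prefix-free domain. -/
def IsPrefixFreeMachine (M : List Bool →. List Bool) : Prop :=
  Partrec M ∧ ∀ p q : List Bool, (M p).Dom → (M q).Dom → p <+: q → p = q

/-- An optimal prefix-free machine. -/
def IsOptimalMachine (U : List Bool →. List Bool) : Prop :=
  IsPrefixFreeMachine U ∧ ∀ M : List Bool →. List Bool, IsPrefixFreeMachine M →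
    ∃ d : ℕ, ∀ p : List Bool, (M p).Dom →
      ∃ q : List Bool, q.length ≤ p.length + d ∧ U q = M p

/-- Program-size (Kolmogorov) complexity of `x` with respect to `U`. -/
noncomputable def KC (U : List Bool →. List Bool) (x : List Bool) : ℕ :=
  sInf {n : ℕ | ∃ p : List Bool, p.length = n ∧ x ∈ U p}

/-- The partition function `Z(T)` of `U` at temperature `T`. -/
noncomputable def ZT (U : List Bool →. List Bool) (T : ℝ) : ℝ :=
  ∑' p : {p : List Bool // (U p).Dom}, (2 : ℝ) ^ (-((p.1.length : ℝ)) / T)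

/-- Chaitin's Ω number of `U`. -/
noncomputable def Omega (U : List Bool →. List Bool) : ℝ :=
  ∑' p : {p : List Bool // (U p).Dom}, (2 : ℝ) ^ (-((p.1.length : ℝ)))

/-- The `n`-th bit (0-indexed) of the base-two expansion (with infinitely many zeros)
of the fractional part of `α`. -/
noncomputable def binDigit (α : ℝ) (n : ℕ) : Bool :=
  decide (⌊α * 2 ^ (n + 1)⌋ % 2 = 1)

def ComputableReal (T : ℝ) : Prop :=
  ∃ f : ℕ → ℚ, Computable f ∧ ∀ n : ℕ, |T - (f n : ℝ)| < (2 : ℝ) ^ (-(n : ℤ))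

def WeaklyChaitinRandom (U : List Bool →. List Bool) (X : ℕ → Bool) : Prop :=
  ∃ c : ℕ, ∀ n : ℕ, 1 ≤ n → (n : ℤ) - c ≤ (KC U (pre X n) : ℤ)

def WeaklyChaitinTRandom (U : List Bool →. List Bool) (T : ℝ) (X : ℕ → Bool) : Prop :=
  ∃ c : ℕ, ∀ n : ℕ, 1 ≤ n → T * n - c ≤ (KC U (pre X n) : ℝ)

def StrictlyTCompressible (U : List Bool →. List Bool) (T : ℝ) (X : ℕ → Bool) : Prop :=
  ∃ d : ℕ, ∀ n : ℕ, 1 ≤ n → (KC U (pre X n) : ℝ) ≤ T * n + d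

def StrictlyChaitinTRandom (U : List Bool →. List Bool) (T : ℝ) (X : ℕ → Bool) : Prop :=
  WeaklyChaitinTRandom U T X ∧ StrictlyTCompressible U T X


/-- The raw encoding of rationals. -/
def ratCode (q : ℚ) : ℕ := @Encodable.encode ℚ Rat.instEncodable q

theorem ratCode_ofNat_strictMono : StrictMono fun n => ratCode (Denumerable.ofNat ℚ n) := by
  let := @Encodable.decidableRangeEncode ℚ Rat.instEncodable
  let : Infinite (Set.range (@Encodable.encode ℚ Rat.instEncodable)) :=
    Infinite.of_injective _ (Equiv.ofInjective _ Encodable.encode_injective).injective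
  have key : ∀ n, ratCode (Denumerable.ofNat ℚ n) =
      (Nat.Subtype.ofNat (Set.range (@Encodable.encode ℚ Rat.instEncodable)) n : ℕ) := by
    intro n
    let := Nat.Subtype.denumerable (Set.range (@Encodable.encode ℚ Rat.instEncodable))
    have h1 : Denumerable.ofNat ℚ n = (@Encodable.equivRangeEncode ℚ Rat.instEncodable).symm
        (Denumerable.ofNat (Set.range (@Encodable.encode ℚ Rat.instEncodable)) n) :=
      Denumerable.ofEquiv_ofNat _ (@Encodable.equivRangeEncode ℚ Rat.instEncodable) n
    have h2 : Denumerable.ofNat (Set.range (@Encodable.encode ℚ Rat.instEncodable)) n =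
        Nat.Subtype.ofNat _ n :=
      (Denumerable.ofEquiv_ofNat ℕ _ n).trans rfl
    have h3 : ∀ s, ratCode ((@Encodable.equivRangeEncode ℚ Rat.instEncodable).symm s) = s.1 := by
      intro s
      exact congrArg Subtype.val
        ((@Encodable.equivRangeEncode ℚ Rat.instEncodable).apply_symm_apply s)
    rw [h1, h3, h2]
  apply strictMono_nat_of_lt_succ
  intro n
  rw [key, key]
  exact Nat.Subtype.lt_succ_self _

/-- Numeric characterisation of the codes of rationals. -/
def IsRatCode (m : ℕ) : Prop :=
  0 < m.unpair.2 ∧ ∀ x < m.unpair.2 + 1,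
    ¬ (((m.unpair.1 + 1) / 2) % x = 0 ∧ m.unpair.2 % x = 0 ∧ x ≠ 1)

theorem isRatCode_iff_aux (a d : ℕ) :
    (0 < d ∧ ∀ x < d + 1, ¬ (a % x = 0 ∧ d % x = 0 ∧ x ≠ 1)) ↔ 0 < d ∧ a.Coprime d := by
  refine and_congr_right fun hd => ⟨fun h => ?_, fun h x hx ⟨h1, h2, h3⟩ => ?_⟩
  · by_contra hne
    exact h (a.gcd d) (Nat.lt_succ_of_le (Nat.gcd_le_right _ hd))
      ⟨Nat.mod_eq_zero_of_dvd (Nat.gcd_dvd_left _ _),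
        Nat.mod_eq_zero_of_dvd (Nat.gcd_dvd_right _ _), hne⟩
  · exact h3 (Nat.eq_one_of_dvd_coprimes h (Nat.dvd_of_mod_eq_zero h1) (Nat.dvd_of_mod_eq_zero h2))

theorem ratCode_eq (q : ℚ) : ratCode q = Nat.pair (Encodable.encode q.num) q.den := by
  rfl

theorem int_encode_nat (n : ℕ) : Encodable.encode (n : ℤ) = 2 * n := rfl

theorem int_natAbs (z : ℤ) : z.natAbs = (Encodable.encode z + 1) / 2 := by
  rcases z with n | n
  · change n = (2 * n + 1) / 2
    omega
  · change n + 1 = (2 * n + 1 + 1) / 2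
    omega

theorem isRatCode_iff (m : ℕ) : IsRatCode m ↔ ∃ q, ratCode q = m := by
  unfold IsRatCode
  rw [isRatCode_iff_aux]
  constructor
  · rintro ⟨h1, h2⟩
    set z : ℤ := Denumerable.ofNat ℤ m.unpair.1 with hz
    have hez : Encodable.encode z = m.unpair.1 := by rw [hz]; exact Denumerable.encode_ofNat _
    refine ⟨⟨z, m.unpair.2, h1.ne', ?_⟩, ?_⟩
    · rw [int_natAbs, hez]; exact h2
    · rw [ratCode_eq]
      simp only [hez, Nat.pair_unpair]
  · rintro ⟨q, rfl⟩
    rw [ratCode_eq, Nat.unpair_pair, ← int_natAbs]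
    exact ⟨q.pos, q.reduced⟩

theorem isRatCode_primrec : PrimrecPred IsRatCode := by
  unfold IsRatCode
  have hR : PrimrecRel fun (x m : ℕ) =>
      ¬ (((m.unpair.1 + 1) / 2) % x = 0 ∧ m.unpair.2 % x = 0 ∧ x ≠ 1) := by
    have u1 : Primrec fun p : ℕ × ℕ => p.2.unpair.1 := Primrec.fst.comp (Primrec.unpair.comp Primrec.snd)
    have u2 : Primrec fun p : ℕ × ℕ => p.2.unpair.2 := Primrec.snd.comp (Primrec.unpair.comp Primrec.snd)
    have v : Primrec fun p : ℕ × ℕ => (p.2.unpair.1 + 1) / 2 :=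
      Primrec.nat_div.comp (Primrec.succ.comp u1) (Primrec.const 2)
    refine PrimrecPred.not (PrimrecPred.and ?_ (PrimrecPred.and ?_ (PrimrecPred.not ?_)))
    · exact Primrec.eq.comp (Primrec.nat_mod.comp v Primrec.fst) (Primrec.const 0)
    · exact Primrec.eq.comp (Primrec.nat_mod.comp u2 Primrec.fst) (Primrec.const 0)
    · exact Primrec.eq.comp Primrec.fst (Primrec.const 1)
  have u2 : Primrec fun m : ℕ => m.unpair.2 := Primrec.snd.comp Primrec.unpair
  refine PrimrecPred.and ?_ ?_
  · exact Primrec.nat_lt.comp (Primrec.const 0) u2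
  · exact (PrimrecRel.forall_lt hR).comp (Primrec.succ.comp u2) Primrec.id

open Classical in
theorem rat_encode_eq (q : ℚ) :
    @Encodable.encode ℚ (Primcodable.toEncodable) q =
      ((List.range (ratCode q)).filter (fun m => IsRatCode m)).length := by
  obtain ⟨n, rfl⟩ : ∃ n, q = Denumerable.ofNat ℚ n :=
    ⟨@Encodable.encode ℚ Denumerable.toEncodable q, (Denumerable.ofNat_encode q).symm⟩
  have h1 : @Encodable.encode ℚ (Primcodable.toEncodable) (Denumerable.ofNat ℚ n) = n :=
    Denumerable.encode_ofNat n
  rw [h1]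
  have hs := ratCode_ofNat_strictMono
  have h2 : ((Finset.range (ratCode (Denumerable.ofNat ℚ n))).filter IsRatCode) =
      (Finset.range n).image fun n => ratCode (Denumerable.ofNat ℚ n) := by
    ext m
    simp only [Finset.mem_filter, Finset.mem_range, Finset.mem_image]
    constructor
    · rintro ⟨hm, hq⟩
      obtain ⟨q, rfl⟩ := (isRatCode_iff m).1 hq
      obtain ⟨k, rfl⟩ : ∃ n, q = Denumerable.ofNat ℚ n :=
        ⟨@Encodable.encode ℚ Denumerable.toEncodable q, (Denumerable.ofNat_encode q).symm⟩
      exact ⟨k, hs.lt_iff_lt.1 hm, rfl⟩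
    · rintro ⟨k, hk, rfl⟩
      exact ⟨hs hk, (isRatCode_iff _).2 ⟨_, rfl⟩⟩
  have h3 := congrArg Finset.card h2
  rw [Finset.card_image_of_injective _ hs.injective, Finset.card_range] at h3
  exact h3.symm

theorem natCast_rat_computable : Computable (fun n : ℕ => (n : ℚ)) := by
  classical
  refine Primrec.to_comp (Primrec.encode_iff.1 ?_)
  have h : Primrec fun n : ℕ =>
      ((List.range (Nat.pair (2 * n) 1)).filter (fun m => IsRatCode m)).length :=
    Primrec.list_length.comp ((Primrec.listFilter isRatCode_primrec).comp
      (Primrec.list_range.comp (Primrec₂.natPair.comp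
        (Primrec.nat_mul.comp (Primrec.const 2) Primrec.id) (Primrec.const 1))))
  refine h.of_eq fun n => ?_
  rw [rat_encode_eq, ratCode_eq]
  rfl

/-- The new capital after the prediction `p` and the actual bit `o`, from capital `c`. -/
def bet (c : ℕ) (p : Option Bool) (o : Option Bool) : ℕ :=
  if p = none then c else if p = o then 2 * c else 0

/-- The capital after `n` rounds on the string `x`. -/
def capAux (F : List Bool →. Option Bool) (x : List Bool) (n : ℕ) : Part ℕ :=
  n.rec (Part.some 1) fun y IH => IH.bind fun c =>
    (F (x.take y)).bind fun p => Part.some (bet c p x[y]?)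

/-- The capital on the string `x`. -/
def cap (F : List Bool →. Option Bool) (x : List Bool) : Part ℕ := capAux F x x.length

theorem cap_partrec {F : List Bool →. Option Bool} (hF : Partrec F) : Partrec (cap F) := by
  have htake : Computable fun p : List Bool × ℕ => p.1.take p.2 := by
    have h : Primrec fun p : List Bool × ℕ => (List.range p.2).filterMap fun i => p.1[i]? :=
      Primrec.listFilterMap (Primrec.list_range.comp Primrec.snd)
        (Primrec.list_getElem?.comp (Primrec.fst.comp Primrec.fst) Primrec.snd)
    refine (h.of_eq fun p => ?_).to_comp
    obtain ⟨l, n⟩ := p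
    simp only
    induction n with
    | zero => simp
    | succ n ih =>
      rw [List.range_succ, List.filterMap_append, ih, List.take_add_one]
      cases h : l[n]? <;> simp [h]
  have hbet : Computable fun q : ((List Bool) × (ℕ × ℕ)) × Option Bool =>
      bet q.1.2.2 q.2 q.1.1[q.1.2.1]? := by
    have h1 : Primrec fun q : ((List Bool) × (ℕ × ℕ)) × Option Bool => q.1.2.2 :=
      Primrec.snd.comp (Primrec.snd.comp Primrec.fst)
    have h2 : Primrec fun q : ((List Bool) × (ℕ × ℕ)) × Option Bool => q.1.1[q.1.2.1]? :=
      Primrec.list_getElem?.comp (Primrec.fst.comp Primrec.fst)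
        (Primrec.fst.comp (Primrec.snd.comp Primrec.fst))
    exact (Primrec.ite (Primrec.eq.comp Primrec.snd (Primrec.const none)) h1
      (Primrec.ite (Primrec.eq.comp Primrec.snd h2)
        (Primrec.nat_mul.comp (Primrec.const 2) h1) (Primrec.const 0))).to_comp
  have hstep : Partrec₂ fun (x : List Bool) (yc : ℕ × ℕ) =>
      (F (x.take yc.1)).bind fun p => Part.some (bet yc.2 p x[yc.1]?) := by
    refine Partrec.bind (hF.comp (htake.comp (Computable.pair Computable.fst
      (Computable.fst.comp Computable.snd)))) ?_
    exact hbet.partrec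
  exact Partrec.nat_rec (f := List.length) Computable.list_length
    (Computable.const (1 : ℕ)).partrec hstep

theorem capAux_succ (F : List Bool →. Option Bool) (x : List Bool) (n : ℕ) :
    capAux F x (n + 1) = (capAux F x n).bind fun c =>
      (F (x.take n)).bind fun p => Part.some (bet c p x[n]?) := rfl

theorem capAux_append (F : List Bool →. Option Bool) (x : List Bool) (b : Bool) (n : ℕ)
    (hn : n ≤ x.length) : capAux F (x ++ [b]) n = capAux F x n := by
  induction n with
  | zero => rfl
  | succ n ih =>
    have h1 : (x ++ [b]).take n = x.take n := List.take_append_of_le_length (by omega)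
    have h2 : (x ++ [b])[n]? = x[n]? := List.getElem?_append_left (by omega)
    rw [capAux_succ, capAux_succ, ih (by omega), h1, h2]

theorem cap_append (F : List Bool →. Option Bool) (x : List Bool) (b : Bool) :
    cap F (x ++ [b]) = (cap F x).bind fun c => (F x).bind fun p =>
      Part.some (bet c p (some b)) := by
  have h0 : cap F (x ++ [b]) = capAux F (x ++ [b]) (x.length + 1) := by simp [cap]
  rw [h0, capAux_succ, capAux_append F x b _ le_rfl]
  simp [cap]

theorem cap_append_dom (F : List Bool →. Option Bool) (x : List Bool) (b : Bool) :
    (cap F (x ++ [b])).Dom ↔ (cap F x).Dom ∧ (F x).Dom := by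
  rw [cap_append]
  simp [Part.bind_dom]

theorem mem_cap_append {F : List Bool →. Option Bool} {x : List Bool} {b : Bool} {c : ℕ} :
    c ∈ cap F (x ++ [b]) ↔ ∃ c₀ ∈ cap F x, ∃ p ∈ F x, c = bet c₀ p (some b) := by
  rw [cap_append]
  simp [Part.mem_bind_iff]

theorem pre_succ (X : ℕ → Bool) (n : ℕ) : pre X (n + 1) = pre X n ++ [X n] := by
  simp [pre, List.range_succ]

theorem cap_martingale {F : List Bool →. Option Bool} (hF : Partrec F) :
    PartialComputableMartingale fun x => (cap F x).map fun n : ℕ => (n : ℚ) := by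
  refine ⟨(cap_partrec hF).map (natCast_rat_computable.comp Computable.snd).to₂, ?_, ?_, ?_, ?_⟩
  · intro x q hq
    obtain ⟨n, -, rfl⟩ := (Part.mem_map_iff _).1 hq
    positivity
  · intro x y hxy hy
    change (cap F y).Dom at hy
    change (cap F x).Dom
    induction y using List.reverseRecOn with
    | nil => rw [List.prefix_nil.1 hxy]; exact hy
    | append_singleton y b ih =>
      rcases List.prefix_concat_iff.1 hxy with h | h
      · rw [h]; exact hy
      · exact ih h ((cap_append_dom F y b).1 hy).1
  · intro x _
    change (cap F _).Dom ↔ (cap F _).Dom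
    rw [cap_append_dom, cap_append_dom]
  · intro x q q₀ q₁ hq h0 h1
    obtain ⟨n, hn, rfl⟩ := (Part.mem_map_iff _).1 hq
    obtain ⟨n0, hn0, rfl⟩ := (Part.mem_map_iff _).1 h0
    obtain ⟨n1, hn1, rfl⟩ := (Part.mem_map_iff _).1 h1
    obtain ⟨c, hc, p, hp, rfl⟩ := mem_cap_append.1 hn0
    obtain ⟨c2, hc2, p2, hp2, rfl⟩ := mem_cap_append.1 hn1
    obtain rfl := Part.mem_unique hc hn
    obtain rfl := Part.mem_unique hc2 hc
    obtain rfl := Part.mem_unique hp hp2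
    rcases p with _ | _ | _ <;> simp [bet] <;> ring

theorem partialComputablyRandom_not_stronglyPredictable (X : ℕ → Bool)
    (h : PartialComputablyRandom X) : ¬ StronglyPredictable X := by
  rintro ⟨F, hF, hdom, hcorr, hinf⟩
  have hex : ∀ n, ∃ c, c ∈ cap F (pre X n) := by
    intro n
    rw [← Part.dom_iff_mem]
    induction n with
    | zero => exact trivial
    | succ n ih => rw [pre_succ, cap_append_dom]; exact ⟨ih, hdom n⟩
  choose c hc using hex
  have hstep : ∀ n, ∃ p ∈ F (pre X n), c (n + 1) = bet (c n) p (some (X n)) := by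
    intro n
    have h1 := hc (n + 1)
    rw [pre_succ] at h1
    obtain ⟨c₀, hc₀, p, hp, he⟩ := mem_cap_append.1 h1
    obtain rfl := Part.mem_unique hc₀ (hc n)
    exact ⟨p, hp, he⟩
  have hwin : ∀ n b, some b ∈ F (pre X n) → c (n + 1) = 2 * c n := by
    intro n b hb
    obtain ⟨p, hp, he⟩ := hstep n
    obtain rfl := Part.mem_unique hp hb
    rw [he, hcorr n b hb]
    simp [bet]
  have hmono : Monotone c := by
    refine monotone_nat_of_le_succ fun n => ?_
    obtain ⟨p, hp, he⟩ := hstep n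
    rcases p with _ | b
    · rw [he]; simp [bet]
    · rw [hwin n b hp]; omega
  have hc0 : c 0 = 1 := Part.mem_unique (hc 0) (Part.mem_some 1)
  have hunb : ∀ k : ℕ, ∃ n, k < c n := by
    intro k
    induction k with
    | zero => exact ⟨0, by omega⟩
    | succ k ih =>
      obtain ⟨n, hn⟩ := ih
      obtain ⟨m, ⟨b, hb⟩, hm⟩ := hinf.exists_gt n
      have h1 := hmono hm.le
      have h2 := hwin m b hb
      exact ⟨m + 1, by omega⟩
  refine h _ (cap_martingale hF) ⟨fun n => Part.dom_iff_mem.2 ⟨_, Part.mem_map _ (hc n)⟩, fun C => ?_⟩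
  obtain ⟨k, hk⟩ := exists_nat_gt C
  obtain ⟨n, hn⟩ := hunb k
  exact ⟨n, _, Part.mem_map _ (hc n), hk.trans (by exact_mod_cast hn)⟩
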